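/- arXiv:1907.06224 — 3 statements merged into one kernel-verified Lean document; each statement's English description precedes it below -/
import Mathlib

section
/- Let u : A → B be a decomposable map between C*-algebras satisfying u(x*) = u(x)* for all x. Then ‖u‖_dec = inf{ ‖u₁ + u₂‖ : u₁, u₂ : A → B completely positive with u = u₁ − u₂ }. -/
noncomputable section

def IsStarSquare {R n : Type*} [Fintype n] [NonUnitalSemiring R] [StarRing R]
    (M : Matrix n n R) : Prop :=
  ∃ N : Matrix n n R, M = N.conjTranspose * N

/-- A (not necessarily linear) map between `*`-rings is *completely positive* if all of its
matrix amplifications send positive matrices (i.e. star-squares) to positive matrices. -/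
def IsCPMap {A B : Type*} [NonUnitalSemiring A] [StarRing A] [NonUnitalSemiring B] [StarRing B]
    (u : A → B) : Prop :=
  ∀ (k : ℕ) (M : Matrix (Fin k) (Fin k) A), IsStarSquare M → IsStarSquare (M.map u)

section Dec

variable {A B : Type*} [NonUnitalNormedRing A] [StarRing A] [NormedSpace ℂ A]
  [NonUnitalNormedRing B] [StarRing B] [NormedSpace ℂ B]

/-- The set of `max ‖S₁‖ ‖S₂‖` over all completely positive `S₁, S₂` making the
2×2 sandwich map completely positive. -/
def decSet (u : A →L[ℂ] B) : Set ℝ :=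
  { r | ∃ S₁ S₂ : A →L[ℂ] B, IsCPMap ⇑S₁ ∧ IsCPMap ⇑S₂ ∧
      IsCPMap (fun x => (!![S₁ x, u x; star (u (star x)), S₂ x] : Matrix (Fin 2) (Fin 2) B)) ∧
      r = max ‖S₁‖ ‖S₂‖ }

/-- A map is decomposable when it is a linear combination of completely positive maps. -/
def IsDecomposable (u : A →L[ℂ] B) : Prop :=
  ∃ u₁ u₂ u₃ u₄ : A →L[ℂ] B, IsCPMap ⇑u₁ ∧ IsCPMap ⇑u₂ ∧ IsCPMap ⇑u₃ ∧ IsCPMap ⇑u₄ ∧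
    u = u₁ - u₂ + Complex.I • (u₃ - u₄)

/-- Haagerup's decomposable norm. -/
def decNorm (u : A →L[ℂ] B) : ℝ := sInf (decSet u)

end Dec

theorem exists_star_mul_self_add {C : Type*} [NonUnitalCStarAlgebra C] (p q : C) :
    ∃ r : C, star p * p + star q * q = star r * r := by
  let _ : PartialOrder C := CStarAlgebra.spectralOrder C
  have _ : StarOrderedRing C := CStarAlgebra.spectralOrderedRing C
  exact CStarAlgebra.nonneg_iff_eq_star_mul_self.mp
    (add_nonneg (star_mul_self_nonneg p) (star_mul_self_nonneg q))

theorem IsStarSquare.add' {B n : Type*} [Fintype n] [NonUnitalCStarAlgebra B]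
    {M N : Matrix n n B} (hM : IsStarSquare M) (hN : IsStarSquare N) : IsStarSquare (M + N) := by
  let _ : PartialOrder B := CStarAlgebra.spectralOrder B
  have _ : StarOrderedRing B := CStarAlgebra.spectralOrderedRing B
  obtain ⟨P, rfl⟩ := hM
  obtain ⟨Q, rfl⟩ := hN
  obtain ⟨R, hR⟩ := exists_star_mul_self_add (C := CStarMatrix n n B)
    (CStarMatrix.ofMatrix P) (CStarMatrix.ofMatrix Q)
  exact ⟨CStarMatrix.ofMatrix.symm R, hR⟩

theorem IsCPMap.add' {A B : Type*} [NonUnitalCStarAlgebra A] [NonUnitalCStarAlgebra B]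
    {u v : A → B} (hu : IsCPMap u) (hv : IsCPMap v) : IsCPMap (fun x => u x + v x) :=
  fun k M hM => (hu k M hM).add' (hv k M hM)

theorem isCPMap_sandwich {A B : Type*} [NonUnitalCStarAlgebra A] [NonUnitalCStarAlgebra B]
    {u v : A → B} (hu : IsCPMap u) (hv : IsCPMap v) :
    IsCPMap (fun x => (!![u x + v x, u x - v x; u x - v x, u x + v x] :
      Matrix (Fin 2) (Fin 2) B)) := by
  intro k M hM
  obtain ⟨N, hN⟩ := hu k M hM
  obtain ⟨L, hL⟩ := hv k M hM
  have hN' : ∀ i j, u (M i j) = ∑ l, star (N l i) * N l j := fun i j => by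
    have := congrFun (congrFun hN i) j
    simpa [Matrix.mul_apply] using this
  have hL' : ∀ i j, v (M i j) = ∑ l, star (L l i) * L l j := fun i j => by
    have := congrFun (congrFun hL i) j
    simpa [Matrix.mul_apply] using this
  refine ⟨Matrix.of fun i j => !![N i j, N i j; L i j, -L i j], ?_⟩
  ext i j a b
  simp only [Matrix.map_apply, hN', hL', Matrix.mul_apply, Matrix.conjTranspose_apply,
    Matrix.of_apply, Matrix.sum_apply, Matrix.star_apply, Fin.sum_univ_two]
  fin_cases a <;> fin_cases b <;>
    simp [Finset.sum_add_distrib, Finset.sum_sub_distrib, sub_eq_add_neg]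

/-- Compress the sandwich map by a column `(1, e)`, `e = ±1`. -/
theorem isCPMap_compress {A B : Type*} [NonUnitalCStarAlgebra A] [NonUnitalCStarAlgebra B]
    {s t u v : A → B} (e : ℤ) 
    (h : IsCPMap (fun x => (!![s x, u x; v x, t x] : Matrix (Fin 2) (Fin 2) B))) :
    IsCPMap (fun x => (4⁻¹ : ℝ) • (s x + e • u x + (e • v x + e • e • t x))) := by
  intro k M hM
  obtain ⟨N, hN⟩ := h k M hM
  have key : ∀ i j a b, (!![s (M i j), u (M i j); v (M i j), t (M i j)] :
      Matrix (Fin 2) (Fin 2) B) a b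
      = ∑ l, (star (N l i 0 a) * N l j 0 b + star (N l i 1 a) * N l j 1 b) := by
    intro i j a b
    have := congrFun (congrFun (congrFun (congrFun hN i) j) a) b
    simpa only [Matrix.map_apply, Matrix.mul_apply, Matrix.conjTranspose_apply,
      Matrix.sum_apply, Matrix.star_apply, Fin.sum_univ_two] using this
  let R : Fin 2 → Matrix (Fin k) (Fin k) B :=
    fun c => Matrix.of fun l i => (2⁻¹ : ℝ) • (N l i c 0 + e • N l i c 1)
  have hs : IsStarSquare ((R 0).conjTranspose * R 0 + (R 1).conjTranspose * R 1) :=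
    IsStarSquare.add' ⟨_, rfl⟩ ⟨_, rfl⟩
  convert hs using 1
  ext i j
  have h00 := key i j 0 0
  have h01 := key i j 0 1
  have h10 := key i j 1 0
  have h11 := key i j 1 1
  simp only [Matrix.of_apply, Matrix.cons_val', Matrix.cons_val_zero, Matrix.cons_val_one,
    Matrix.cons_val_fin_one] at h00 h01 h10 h11
  simp only [Matrix.map_apply, h00, h01, h10, h11, Matrix.add_apply, Matrix.mul_apply,
    Matrix.conjTranspose_apply, R, Matrix.of_apply]
  simp only [Finset.smul_sum, ← Finset.sum_add_distrib]
  refine Finset.sum_congr rfl fun l _ => ?_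
  have h4 : (4⁻¹ : ℝ) = 2⁻¹ * 2⁻¹ := by norm_num
  simp only [star_smul, star_add, star_trivial, star_zsmul, smul_mul_assoc, mul_smul_comm, add_mul,
    mul_add, smul_smul, h4, smul_add]
  module

/-- For a self-adjoint decomposable map `u` between C*-algebras,
`‖u‖_dec = inf { ‖u₁ + u₂‖ : u₁, u₂ completely positive, u = u₁ - u₂ }`. -/
theorem decNorm_selfAdjoint_eq
    {A B : Type*} [NonUnitalCStarAlgebra A] [NonUnitalCStarAlgebra B]
    (u : A →L[ℂ] B) (hdec : IsDecomposable u) (hsa : ∀ x, u (star x) = star (u x)) :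
    decNorm u = sInf { r | ∃ u₁ u₂ : A →L[ℂ] B, IsCPMap ⇑u₁ ∧ IsCPMap ⇑u₂ ∧
      u = u₁ - u₂ ∧ r = ‖u₁ + u₂‖ } := by
  have hsub : ∀ r, (∃ u₁ u₂ : A →L[ℂ] B, IsCPMap ⇑u₁ ∧ IsCPMap ⇑u₂ ∧
      u = u₁ - u₂ ∧ r = ‖u₁ + u₂‖) → r ∈ decSet u := by
    rintro r ⟨u₁, u₂, h₁, h₂, rfl, rfl⟩
    refine ⟨u₁ + u₂, u₁ + u₂, h₁.add' h₂, h₁.add' h₂, ?_, by simp⟩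
    have := isCPMap_sandwich h₁ h₂
    convert this using 3 with x
    rw [hsa, star_star]
    rfl
  have hdom : ∀ r ∈ decSet u, ∃ r' ≤ r, ∃ u₁ u₂ : A →L[ℂ] B, IsCPMap ⇑u₁ ∧ IsCPMap ⇑u₂ ∧
      u = u₁ - u₂ ∧ r' = ‖u₁ + u₂‖ := by
    rintro r ⟨S₁, S₂, -, -, h, rfl⟩
    have e : ∀ x, star (u (star x)) = u x := fun x => by rw [hsa, star_star]
    simp only [e] at h
    have hp := isCPMap_compress 1 h
    have hm := isCPMap_compress (-1) h
    let v₁ : A →L[ℂ] B := (4⁻¹ : ℝ) • (S₁ + (1 : ℤ) • u + ((1 : ℤ) • u + (1 : ℤ) • (1 : ℤ) • S₂))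
    let v₂ : A →L[ℂ] B :=
      (4⁻¹ : ℝ) • (S₁ + (-1 : ℤ) • u + ((-1 : ℤ) • u + (-1 : ℤ) • (-1 : ℤ) • S₂))
    have hsum : v₁ + v₂ = (2⁻¹ : ℝ) • (S₁ + S₂) := by
      simp only [v₁, v₂, one_smul, neg_smul, neg_neg]
      module
    refine ⟨‖v₁ + v₂‖, ?_, v₁, v₂, hp, hm, ?_, rfl⟩
    · rw [hsum, norm_smul]
      have h1 := norm_add_le S₁ S₂
      have h2 := le_max_left ‖S₁‖ ‖S₂‖
      have h3 := le_max_right ‖S₁‖ ‖S₂‖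
      have h4 : ‖(2⁻¹ : ℝ)‖ = 2⁻¹ := by norm_num
      rw [h4]
      linarith
    · simp only [v₁, v₂, one_smul, neg_smul, neg_neg]
      module
  have hbd1 : BddBelow (decSet u) := by
    refine ⟨0, ?_⟩
    rintro r ⟨S₁, S₂, -, -, -, rfl⟩
    exact (norm_nonneg S₁).trans (le_max_left _ _)
  have hbd2 : BddBelow { r | ∃ u₁ u₂ : A →L[ℂ] B, IsCPMap ⇑u₁ ∧ IsCPMap ⇑u₂ ∧
      u = u₁ - u₂ ∧ r = ‖u₁ + u₂‖ } := hbd1.mono hsub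
  unfold decNorm
  rcases Set.eq_empty_or_nonempty (decSet u) with h0 | h0
  · congr 1
    rw [h0, eq_comm, Set.eq_empty_iff_forall_notMem]
    intro r hr
    have := hsub r hr
    rw [h0] at this
    exact this
  · apply le_antisymm
    · obtain ⟨r, hr⟩ := h0
      obtain ⟨r', -, hr'⟩ := hdom r hr
      exact csInf_le_csInf hbd1 ⟨r', hr'⟩ hsub
    · refine le_csInf h0 fun r hr => ?_
      obtain ⟨r', hle, hr'⟩ := hdom r hr
      exact (csInf_le hbd2 hr').trans hle
end
end

section
/- Let u : A → B be a linear map between C*-algebras, and define u_*(x) = u(x*)* and ũ : A → M₂(B) by ũ(x) = [[0, u(x)], [u_*(x), 0]]. Then u is decomposable if and only if ũ is decomposable, and in that case ‖u‖_dec = ‖ũ‖_dec. -/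
noncomputable section

section Helpers

lemma aux_sqrt {C : Type*} [NonUnitalCStarAlgebra C] [PartialOrder C] [StarOrderedRing C]
    {a : C} (h : 0 ≤ a) : ∃ x : C, a = star x * x :=
  CStarAlgebra.nonneg_iff_eq_star_mul_self.mp h

lemma aux_gram_order {B m n : Type*} [NonUnitalCStarAlgebra B] [PartialOrder B]
    [StarOrderedRing B] [Fintype m] [Fintype n] (N : Matrix m n B) :
    IsStarSquare (N.conjTranspose * N) := by
  classical
  rcases isEmpty_or_nonempty n with hn | ⟨⟨i0⟩⟩
  · exact ⟨0, by ext i; exact hn.elim i⟩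
  let R : m → CStarMatrix n n B := fun r => CStarMatrix.ofMatrix
    (Matrix.of fun i j => if i = i0 then N r j else 0)
  have h0 : (0 : CStarMatrix n n B) ≤ ∑ r, star (R r) * R r :=
    Finset.sum_nonneg fun r _ => star_mul_self_nonneg _
  obtain ⟨x, hx⟩ := aux_sqrt h0
  refine ⟨CStarMatrix.ofMatrix.symm x, ?_⟩
  have h1 : N.conjTranspose * N = CStarMatrix.ofMatrix.symm (∑ r, star (R r) * R r) := by
    have : ∀ (i j : n), (∑ r, star (R r) * R r : CStarMatrix n n B) i j
        = ∑ r, (star (R r) * R r : CStarMatrix n n B) i j := by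
      intro i j
      exact Matrix.sum_apply i j Finset.univ (fun r => (star (R r) * R r : CStarMatrix n n B))
    ext i j
    refine Eq.trans ?_ (this i j).symm
    rw [Matrix.mul_apply]
    refine Finset.sum_congr rfl fun r _ => ?_
    rw [CStarMatrix.mul_apply, Finset.sum_eq_single i0]
    · simp [CStarMatrix.star_apply, R]
    · intro b _ hb
      simp [R, hb]
    · simp
  rw [h1, hx]
  rfl

lemma aux_gram {B m n : Type*} [NonUnitalCStarAlgebra B] [Fintype m] [Fintype n]
    (N : Matrix m n B) : IsStarSquare (N.conjTranspose * N) := by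
  letI := CStarAlgebra.spectralOrder B
  haveI := CStarAlgebra.spectralOrderedRing B
  exact aux_gram_order N

lemma aux_add {B n : Type*} [NonUnitalCStarAlgebra B] [Fintype n] {M M' : Matrix n n B}
    (h : IsStarSquare M) (h' : IsStarSquare M') : IsStarSquare (M + M') := by
  obtain ⟨N, rfl⟩ := h
  obtain ⟨N', rfl⟩ := h'
  have := aux_gram (Matrix.fromRows N N')
  convert this using 1
  ext i j
  simp [Matrix.mul_apply, Matrix.conjTranspose_apply, Fintype.sum_sum_type]

lemma aux_schur {B m n t : Type*} [NonUnitalCStarAlgebra B] [Fintype m] [Fintype n] [Fintype t]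
    [DecidableEq t] (f : n → m) (g : n → t) {M : Matrix m m B} (h : IsStarSquare M) :
    IsStarSquare (Matrix.of fun x y => if g x = g y then M (f x) (f y) else 0) := by
  obtain ⟨N, rfl⟩ := h
  have := aux_gram (Matrix.of fun (p : m × t) (x : n) => if g x = p.2 then N p.1 (f x) else 0)
  convert this using 1
  ext x y
  simp only [Matrix.mul_apply, Matrix.of_apply, Matrix.conjTranspose_apply, Fintype.sum_prod_type]
  by_cases hxy : g x = g y
  · simp [hxy, Matrix.mul_apply]
  · simp only [hxy, if_false]
    symm
    refine Finset.sum_eq_zero fun r _ => Finset.sum_eq_zero fun s _ => ?_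
    by_cases h1 : g x = s
    · have : g y ≠ s := fun h2 => hxy (h1.trans h2.symm)
      simp [this]
    · simp [h1]

lemma aux_submatrix {B m n : Type*} [NonUnitalCStarAlgebra B] [Fintype m] [Fintype n]
    (f : n → m) {M : Matrix m m B} (h : IsStarSquare M) : IsStarSquare (M.submatrix f f) := by
  obtain ⟨N, rfl⟩ := h
  have := aux_gram (N.submatrix id f)
  convert this using 1
  ext i j
  simp [Matrix.mul_apply]

lemma aux_comp {B m n : Type*} [NonUnitalSemiring B] [StarRing B] [Fintype m] [Fintype n]
    (M : Matrix m m (Matrix n n B)) :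
    IsStarSquare M ↔ IsStarSquare (Matrix.comp m m n n B M) := by
  have key : ∀ N : Matrix m m (Matrix n n B), Matrix.comp m m n n B (N.conjTranspose * N)
      = (Matrix.comp m m n n B N).conjTranspose * Matrix.comp m m n n B N := by
    intro N
    exact (map_mul (Matrix.compRingEquiv m n B) N.conjTranspose N)
  constructor
  · rintro ⟨N, rfl⟩
    exact ⟨_, key N⟩
  · rintro ⟨N, hN⟩
    refine ⟨(Matrix.comp m m n n B).symm N, ?_⟩
    apply (Matrix.comp m m n n B).injective
    rw [key, hN]
    simp

lemma aux_hom {F A B n : Type*} [NonUnitalSemiring A] [StarRing A] [NonUnitalSemiring B]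
    [StarRing B] [Fintype n] [FunLike F A B] [NonUnitalRingHomClass F A B] [StarHomClass F A B]
    (φ : F) {M : Matrix n n A}
    (h : IsStarSquare M) : IsStarSquare (M.map φ) := by
  obtain ⟨N, rfl⟩ := h
  refine ⟨N.map φ, ?_⟩
  ext i j
  simp [Matrix.mul_apply, map_sum, map_mul, map_star]

lemma aux_cp_hom {F A B C : Type*} [NonUnitalSemiring A] [StarRing A] [NonUnitalSemiring B]
    [StarRing B] [NonUnitalSemiring C] [StarRing C]
    [FunLike F B C] [NonUnitalRingHomClass F B C] [StarHomClass F B C]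
    (φ : F) {f : A → B} (h : IsCPMap f) : IsCPMap (fun x => φ (f x)) := by
  intro k M hM
  exact aux_hom φ (h k M hM)

lemma aux_cp_add {A B : Type*} [NonUnitalSemiring A] [StarRing A] [NonUnitalCStarAlgebra B]
    {f g : A → B} (h : IsCPMap f) (h' : IsCPMap g) : IsCPMap (fun x => f x + g x) := by
  intro k M hM
  exact aux_add (h k M hM) (h' k M hM)

lemma aux_cp_zero {A B : Type*} [NonUnitalSemiring A] [StarRing A] [NonUnitalCStarAlgebra B] :
    IsCPMap (fun _ : A => (0 : B)) := by
  intro k M hM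
  exact ⟨0, by ext; simp⟩

/-- scalar compression of a matrix-valued completely positive map -/
lemma aux_cp_compress {A B n : Type*} [NonUnitalSemiring A] [StarRing A]
    [NonUnitalCStarAlgebra B] [Fintype n] (w : n → ℂ) {f : A → Matrix n n B} (h : IsCPMap f) :
    IsCPMap (fun x => ∑ i, ∑ j, (star (w i) * w j) • f x i j) := by
  intro k M hM
  obtain ⟨N, hN⟩ := h k M hM
  have := aux_gram (Matrix.of fun (rs : Fin k × n) (p : Fin k) => ∑ i, w i • N rs.1 p rs.2 i)
  convert this using 1
  ext p q
  have hf : ∀ i j, f (M p q) i j = ∑ r, ∑ s, star (N r p s i) * N r q s j := by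
    intro i j
    have := congrFun (congrFun hN p) q
    rw [Matrix.map_apply] at this
    rw [this, Matrix.mul_apply, Matrix.sum_apply]
    simp [Matrix.mul_apply, Matrix.star_apply]
  simp only [Matrix.map_apply, hf, Matrix.mul_apply, Matrix.conjTranspose_apply, Matrix.of_apply,
    Fintype.sum_prod_type, star_sum, star_smul, Finset.sum_mul_sum, Finset.smul_sum, smul_mul_smul_comm]
  rw [Finset.sum_congr rfl fun i _ => Finset.sum_comm, Finset.sum_comm]
  refine Finset.sum_congr rfl fun r _ => ?_
  rw [Finset.sum_congr rfl fun i _ => Finset.sum_comm, Finset.sum_comm]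

lemma aux_entry_order {B M₂B : Type*} [NonUnitalCStarAlgebra B] [PartialOrder B]
    [StarOrderedRing B] [NonUnitalCStarAlgebra M₂B]
    (e : Matrix (Fin 2) (Fin 2) B ≃⋆ₐ[ℂ] M₂B) (y : M₂B) (i j : Fin 2) :
    ‖e.symm y i j‖ ≤ ‖y‖ := by
  let φ : M₂B →⋆ₙₐ[ℂ] CStarMatrix (Fin 2) (Fin 2) B :=
    { toFun := fun y => CStarMatrix.ofMatrix (e.symm y)
      map_smul' := fun c x => by rw [map_smul]; rfl
      map_zero' := by rw [map_zero]; rfl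
      map_add' := fun c x => by rw [map_add]; rfl
      map_mul' := fun c x => by rw [map_mul]; rfl
      map_star' := fun x => by rw [map_star]; rfl }
  have h := NonUnitalStarAlgHom.norm_map φ
    (fun a b hab => e.symm.injective (CStarMatrix.ofMatrix.injective hab)) y
  rw [← h]
  exact CStarMatrix.norm_entry_le_norm (M := φ y)

lemma aux_entry {B M₂B : Type*} [NonUnitalCStarAlgebra B] [NonUnitalCStarAlgebra M₂B]
    (e : Matrix (Fin 2) (Fin 2) B ≃⋆ₐ[ℂ] M₂B) (y : M₂B) (i j : Fin 2) :
    ‖e.symm y i j‖ ≤ ‖y‖ := by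
  letI := CStarAlgebra.spectralOrder B
  haveI := CStarAlgebra.spectralOrderedRing B
  exact aux_entry_order e y i j

def auxEntry {B M₂B : Type*} [NonUnitalCStarAlgebra B] [NonUnitalCStarAlgebra M₂B]
    (e : Matrix (Fin 2) (Fin 2) B ≃⋆ₐ[ℂ] M₂B) (i j : Fin 2) : M₂B →L[ℂ] B :=
  LinearMap.mkContinuous
    { toFun := fun y => e.symm y i j
      map_add' := fun x y => by rw [map_add]; rfl
      map_smul' := fun c x => by rw [map_smul]; rfl } 1
    (fun y => by rw [one_mul]; exact aux_entry e y i j)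

lemma auxEntry_apply {B M₂B : Type*} [NonUnitalCStarAlgebra B] [NonUnitalCStarAlgebra M₂B]
    (e : Matrix (Fin 2) (Fin 2) B ≃⋆ₐ[ℂ] M₂B) (i j : Fin 2) (y : M₂B) :
    auxEntry e i j y = e.symm y i j := rfl

lemma auxEntry_comp_norm {A B M₂B : Type*} [NonUnitalCStarAlgebra A] [NonUnitalCStarAlgebra B]
    [NonUnitalCStarAlgebra M₂B]
    (e : Matrix (Fin 2) (Fin 2) B ≃⋆ₐ[ℂ] M₂B) (i j : Fin 2) (T : A →L[ℂ] M₂B) :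
    ‖(auxEntry e i j).comp T‖ ≤ ‖T‖ :=
  ContinuousLinearMap.opNorm_le_bound _ (norm_nonneg _) fun x =>
    (aux_entry e (T x) i j).trans (T.le_opNorm x)

/-- the diagonal star homomorphism -/
def auxDiag {B M₂B : Type*} [NonUnitalCStarAlgebra B] [NonUnitalCStarAlgebra M₂B]
    (e : Matrix (Fin 2) (Fin 2) B ≃⋆ₐ[ℂ] M₂B) : (B × B) →⋆ₙₐ[ℂ] M₂B where
  toFun b := e !![b.1, 0; 0, b.2]
  map_smul' c b := by
    rw [← map_smul]; congr 1; ext i j; fin_cases i <;> fin_cases j <;> simp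
  map_zero' := by
    rw [← map_zero e]; congr 1; ext i j; fin_cases i <;> fin_cases j <;> simp
  map_add' b c := by
    rw [← map_add]; congr 1; ext i j; fin_cases i <;> fin_cases j <;> simp
  map_mul' b c := by
    rw [← map_mul]; congr 1; ext i j; fin_cases i <;> fin_cases j <;> simp
  map_star' b := by
    rw [← map_star]; congr 1; ext i j; fin_cases i <;> fin_cases j <;> simp [Matrix.star_apply]

lemma auxDiag_norm {B M₂B : Type*} [NonUnitalCStarAlgebra B] [NonUnitalCStarAlgebra M₂B]
    (e : Matrix (Fin 2) (Fin 2) B ≃⋆ₐ[ℂ] M₂B) (b : B × B) : ‖auxDiag e b‖ = ‖b‖ := by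
  refine NonUnitalStarAlgHom.norm_map (auxDiag e) (fun b c h => ?_) b
  have h' := e.injective h
  have h0 := congrFun (congrFun h' 0) 0
  have h1 := congrFun (congrFun h' 1) 1
  exact Prod.ext (by simpa using h0) (by simpa using h1)

def auxDiagL {B M₂B : Type*} [NonUnitalCStarAlgebra B] [NonUnitalCStarAlgebra M₂B]
    (e : Matrix (Fin 2) (Fin 2) B ≃⋆ₐ[ℂ] M₂B) : (B × B) →L[ℂ] M₂B :=
  LinearMap.mkContinuous
    { toFun := fun b => auxDiag e b
      map_add' := map_add _
      map_smul' := fun c x => map_smul _ c x } 1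
    (fun y => by rw [one_mul]; exact (auxDiag_norm e y).le)

lemma auxDiagL_apply {B M₂B : Type*} [NonUnitalCStarAlgebra B] [NonUnitalCStarAlgebra M₂B]
    (e : Matrix (Fin 2) (Fin 2) B ≃⋆ₐ[ℂ] M₂B) (b : B × B) :
    auxDiagL e b = e !![b.1, 0; 0, b.2] := rfl

lemma auxDiag_comp_norm {A B M₂B : Type*} [NonUnitalCStarAlgebra A] [NonUnitalCStarAlgebra B]
    [NonUnitalCStarAlgebra M₂B]
    (e : Matrix (Fin 2) (Fin 2) B ≃⋆ₐ[ℂ] M₂B) (S₁ S₂ : A →L[ℂ] B) :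
    ‖(auxDiagL e).comp (S₁.prod S₂)‖ = max ‖S₁‖ ‖S₂‖ := by
  have h : ‖S₁.prod S₂‖ = max ‖S₁‖ ‖S₂‖ := ContinuousLinearMap.opNorm_prod S₁ S₂
  rw [← h]
  apply le_antisymm
  · refine ContinuousLinearMap.opNorm_le_bound _ (norm_nonneg _) fun x => ?_
    exact (auxDiag_norm e _).le.trans ((S₁.prod S₂).le_opNorm x)
  · refine ContinuousLinearMap.opNorm_le_bound _ (norm_nonneg _) fun x => ?_
    exact (auxDiag_norm e _).ge.trans (((auxDiagL e).comp (S₁.prod S₂)).le_opNorm x)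

/-- star homomorphism `b ↦ b ⊗ p`, `p` the projection `½[[1, c],[c̄, 1]]`. -/
def auxPhi {B M₂B : Type*} [NonUnitalCStarAlgebra B] [NonUnitalCStarAlgebra M₂B]
    (e : Matrix (Fin 2) (Fin 2) B ≃⋆ₐ[ℂ] M₂B) (c : ℂ) (hc : c * star c = 1) :
    B →⋆ₙₐ[ℂ] M₂B where
  toFun b := e !![(1 / 2 : ℂ) • b, (c / 2) • b; (star c / 2) • b, (1 / 2 : ℂ) • b]
  map_smul' d b := by
    rw [← map_smul]; congr 1
    ext i j; fin_cases i <;> fin_cases j <;> simp [smul_smul, mul_comm]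
  map_zero' := by
    rw [← map_zero e]; congr 1; ext i j; fin_cases i <;> fin_cases j <;> simp
  map_add' b c := by
    rw [← map_add]; congr 1; ext i j; fin_cases i <;> fin_cases j <;> simp
  map_mul' b d := by
    rw [← map_mul]; congr 1
    ext i j; fin_cases i <;> fin_cases j <;>
      simp only [Fin.zero_eta, Fin.mk_one, Matrix.mul_apply, Fin.sum_univ_two, Matrix.of_apply,
        Matrix.cons_val_zero, Matrix.cons_val_one, smul_mul_smul_comm, ← add_smul] <;>
      congr 1 <;>
      first
        | linear_combination (-1/4 : ℂ) * hc
        | linear_combination (-1/4 : ℂ) * c * hc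
        | linear_combination (-1/4 : ℂ) * star c * hc
        | ring
  map_star' b := by
    rw [← map_star]; congr 1
    ext i j; fin_cases i <;> fin_cases j <;> simp [Matrix.star_apply]


def auxPhiL {B M₂B : Type*} [NonUnitalCStarAlgebra B] [NonUnitalCStarAlgebra M₂B]
    (e : Matrix (Fin 2) (Fin 2) B ≃⋆ₐ[ℂ] M₂B) (c : ℂ) (hc : c * star c = 1) : B →L[ℂ] M₂B :=
  LinearMap.mkContinuous
    { toFun := fun b => auxPhi e c hc b
      map_add' := map_add _
      map_smul' := fun c x => map_smul _ c x } 1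
    (fun y => by rw [one_mul]; exact NonUnitalStarAlgHom.norm_apply_le (auxPhi e c hc) y)

lemma auxPhiL_apply {B M₂B : Type*} [NonUnitalCStarAlgebra B] [NonUnitalCStarAlgebra M₂B]
    (e : Matrix (Fin 2) (Fin 2) B ≃⋆ₐ[ℂ] M₂B) (c : ℂ) (hc : c * star c = 1) (b : B) :
    auxPhiL e c hc b
      = e !![(1 / 2 : ℂ) • b, (c / 2) • b; (star c / 2) • b, (1 / 2 : ℂ) • b] := rfl

lemma auxPhi_cp {A B M₂B : Type*} [NonUnitalCStarAlgebra A] [NonUnitalCStarAlgebra B]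
    [NonUnitalCStarAlgebra M₂B]
    (e : Matrix (Fin 2) (Fin 2) B ≃⋆ₐ[ℂ] M₂B) (c : ℂ) (hc : c * star c = 1) (v : A →L[ℂ] B)
    (hv : IsCPMap v) : IsCPMap ((auxPhiL e c hc).comp v) :=
  aux_cp_hom (auxPhi e c hc) hv

lemma aux_herm {A B : Type*} [NonUnitalCStarAlgebra A] [NonUnitalCStarAlgebra B]
    (v : A →L[ℂ] B) (hv : IsCPMap v) (x : A) : v (star x) = star (v x) := by
  let _ := CStarAlgebra.spectralOrder A
  have _ := CStarAlgebra.spectralOrderedRing A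
  have hx : x ∈ Submodule.span ℂ {a : A | 0 ≤ a} := by
    rw [CStarAlgebra.span_nonneg]; trivial
  induction hx using Submodule.span_induction with
  | mem x hx =>
    obtain ⟨y, hy⟩ := aux_sqrt (show 0 ≤ x by simpa using hx)
    have h1 : star x = x := by rw [hy]; simp
    rw [h1]
    obtain ⟨N, hN⟩ := hv 1 (Matrix.of fun _ _ => x)
      ⟨Matrix.of fun _ _ => y, by ext; simp [Matrix.mul_apply, hy]⟩
    have := congrFun (congrFun hN 0) 0
    simp [Matrix.mul_apply] at this
    rw [this]; simp
  | zero => simp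
  | add x y _ _ hx hy => simp [hx, hy]
  | smul c x _ hx => simp [hx]

lemma aux_decomp_forward {A B M₂B : Type*} [NonUnitalCStarAlgebra A] [NonUnitalCStarAlgebra B]
    [NonUnitalCStarAlgebra M₂B]
    (e : Matrix (Fin 2) (Fin 2) B ≃⋆ₐ[ℂ] M₂B)
    (u : A →L[ℂ] B) (ut : A →L[ℂ] M₂B)
    (hut : ∀ x, ut x = e !![0, u x; star (u (star x)), 0])
    (h : IsDecomposable u) : IsDecomposable ut := by
  obtain ⟨u₁, u₂, u₃, u₄, h₁, h₂, h₃, h₄, hu⟩ := h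
  have c1 : (1 : ℂ) * star 1 = 1 := by simp
  have c2 : (-1 : ℂ) * star (-1) = 1 := by simp
  have c3 : Complex.I * star Complex.I = 1 := by simp
  have c4 : (-Complex.I) * star (-Complex.I) = 1 := by simp
  refine ⟨(auxPhiL e _ c1).comp u₁ + (auxPhiL e _ c2).comp u₂ + (auxPhiL e _ c3).comp u₃
      + (auxPhiL e _ c4).comp u₄,
    (auxPhiL e _ c2).comp u₁ + (auxPhiL e _ c1).comp u₂ + (auxPhiL e _ c4).comp u₃
      + (auxPhiL e _ c3).comp u₄, 0, 0, ?_, ?_, aux_cp_zero, aux_cp_zero, ?_⟩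
  · exact aux_cp_add (aux_cp_add (aux_cp_add (auxPhi_cp _ _ _ _ h₁) (auxPhi_cp _ _ _ _ h₂))
      (auxPhi_cp _ _ _ _ h₃)) (auxPhi_cp _ _ _ _ h₄)
  · exact aux_cp_add (aux_cp_add (aux_cp_add (auxPhi_cp _ _ _ _ h₁) (auxPhi_cp _ _ _ _ h₂))
      (auxPhi_cp _ _ _ _ h₃)) (auxPhi_cp _ _ _ _ h₄)
  · ext x
    have hs : star (u (star x)) = u₁ x - u₂ x - Complex.I • (u₃ x - u₄ x) := by
      rw [hu]
      simp [aux_herm _ h₁, aux_herm _ h₂, aux_herm _ h₃, aux_herm _ h₄, sub_eq_add_neg]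
      abel
    have hx : u x = u₁ x - u₂ x + Complex.I • (u₃ x - u₄ x) := by rw [hu]; simp
    rw [hut, hs, hx]
    simp only [sub_self, smul_zero, add_zero, sub_apply,
      add_apply, ContinuousLinearMap.comp_apply, auxPhiL_apply]
    simp only [← map_add, ← map_sub]
    congr 1
    ext i j
    fin_cases i <;> fin_cases j <;> simp <;> module

def auxPsi {A B M₂B : Type*} [NonUnitalCStarAlgebra A] [NonUnitalCStarAlgebra B]
    [NonUnitalCStarAlgebra M₂B]
    (e : Matrix (Fin 2) (Fin 2) B ≃⋆ₐ[ℂ] M₂B) (w : Fin 2 → ℂ) (T : A →L[ℂ] M₂B) : A →L[ℂ] B :=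
  ∑ i, ∑ j, (star (w i) * w j) • (auxEntry e i j).comp T

lemma auxPsi_cp {A B M₂B : Type*} [NonUnitalCStarAlgebra A] [NonUnitalCStarAlgebra B]
    [NonUnitalCStarAlgebra M₂B]
    (e : Matrix (Fin 2) (Fin 2) B ≃⋆ₐ[ℂ] M₂B) (w : Fin 2 → ℂ) (T : A →L[ℂ] M₂B)
    (hT : IsCPMap T) : IsCPMap (auxPsi e w T) := by
  have := aux_cp_compress w (aux_cp_hom e.symm hT)
  convert this using 2 with x
  simp [auxPsi, auxEntry_apply]

lemma auxPsi_polar {A B M₂B : Type*} [NonUnitalCStarAlgebra A] [NonUnitalCStarAlgebra B]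
    [NonUnitalCStarAlgebra M₂B]
    (e : Matrix (Fin 2) (Fin 2) B ≃⋆ₐ[ℂ] M₂B) (T : A →L[ℂ] M₂B) :
    (auxEntry e 0 1).comp T = auxPsi e ![1/2, 1/2] T - auxPsi e ![1/2, -1/2] T
      + Complex.I • (auxPsi e ![1/2, -Complex.I/2] T - auxPsi e ![1/2, Complex.I/2] T) := by
  simp only [auxPsi, Fin.sum_univ_two, Matrix.cons_val_zero, Matrix.cons_val_one]
  match_scalars <;> simp <;> ring_nf <;> simp <;> norm_num

lemma aux_decomp_backward {A B M₂B : Type*} [NonUnitalCStarAlgebra A] [NonUnitalCStarAlgebra B]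
    [NonUnitalCStarAlgebra M₂B]
    (e : Matrix (Fin 2) (Fin 2) B ≃⋆ₐ[ℂ] M₂B)
    (u : A →L[ℂ] B) (ut : A →L[ℂ] M₂B)
    (hut : ∀ x, ut x = e !![0, u x; star (u (star x)), 0])
    (h : IsDecomposable ut) : IsDecomposable u := by
  obtain ⟨V₁, V₂, V₃, V₄, h₁, h₂, h₃, h₄, hu⟩ := h
  have hu' : u = (auxEntry e 0 1).comp ut := by
    ext x
    simp [auxEntry_apply, hut]
  have hcp : ∀ a b c d : Fin 2 → ℂ,
      IsCPMap (auxPsi e a V₁ + auxPsi e b V₂ + auxPsi e c V₃ + auxPsi e d V₄) := fun a b c d =>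
    aux_cp_add (aux_cp_add (aux_cp_add (auxPsi_cp e _ _ h₁) (auxPsi_cp e _ _ h₂))
      (auxPsi_cp e _ _ h₃)) (auxPsi_cp e _ _ h₄)
  refine ⟨_, _, _, _,
    hcp ![1/2, 1/2] ![1/2, -1/2] ![1/2, Complex.I/2] ![1/2, -Complex.I/2],
    hcp ![1/2, -1/2] ![1/2, 1/2] ![1/2, -Complex.I/2] ![1/2, Complex.I/2],
    hcp ![1/2, -Complex.I/2] ![1/2, Complex.I/2] ![1/2, 1/2] ![1/2, -1/2],
    hcp ![1/2, Complex.I/2] ![1/2, -Complex.I/2] ![1/2, -1/2] ![1/2, 1/2], ?_⟩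
  rw [hu', hu]
  simp only [ContinuousLinearMap.comp_add, ContinuousLinearMap.comp_sub,
    ContinuousLinearMap.comp_smul, auxPsi_polar]
  simp only [smul_add, smul_sub, smul_smul, Complex.I_mul_I, neg_smul, one_smul]
  abel

lemma aux_cp_diag {A B n : Type*} [NonUnitalSemiring A] [StarRing A]
    [NonUnitalCStarAlgebra B] [Fintype n] (i : n) {f : A → Matrix n n B} (h : IsCPMap f) :
    IsCPMap (fun x => f x i i) := by
  intro k M hM
  exact aux_submatrix (fun p => (p, i)) ((aux_comp _).1 (h k M hM))

lemma aux_decSet_subset {A B M₂B : Type*} [NonUnitalCStarAlgebra A] [NonUnitalCStarAlgebra B]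
    [NonUnitalCStarAlgebra M₂B]
    (e : Matrix (Fin 2) (Fin 2) B ≃⋆ₐ[ℂ] M₂B)
    (u : A →L[ℂ] B) (ut : A →L[ℂ] M₂B)
    (hut : ∀ x, ut x = e !![0, u x; star (u (star x)), 0]) : decSet u ⊆ decSet ut := by
  rintro r ⟨S₁, S₂, -, -, h₃, rfl⟩
  have hT : IsCPMap ((auxDiagL e).comp (S₁.prod S₂)) := by
    refine aux_cp_hom e (f := fun x => !![S₁ x, 0; 0, S₂ x]) ?_
    intro k M hM
    rw [aux_comp]
    have := aux_schur id Prod.snd ((aux_comp _).1 (h₃ k M hM))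
    convert this using 1
    ext ⟨p, a⟩ ⟨q, b⟩
    fin_cases a <;> fin_cases b <;> simp
  refine ⟨_, _, hT, hT, ?_, by rw [auxDiag_comp_norm, max_self]⟩
  intro k M hM
  rw [aux_comp]
  have hY : IsStarSquare (Matrix.of fun pa qb : Fin k × Fin 2 =>
      if pa.2 = qb.2 then !![S₁ (M pa.1 qb.1), 0; 0, S₂ (M pa.1 qb.1)]
      else !![0, u (M pa.1 qb.1); star (u (star (M pa.1 qb.1))), 0]) := by
    rw [aux_comp]
    have := aux_schur (fun x : (Fin k × Fin 2) × Fin 2 => (x.1.1, x.2))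
      (fun x => x.1.2 + x.2) ((aux_comp _).1 (h₃ k M hM))
    convert this using 1
    ext ⟨⟨p, a⟩, b⟩ ⟨⟨q, a'⟩, b'⟩
    fin_cases a <;> fin_cases a' <;> fin_cases b <;> fin_cases b' <;> simp
  have := aux_hom e hY
  convert this using 1
  have hst : ∀ x, star (ut (star x)) = ut x := by
    intro x
    rw [hut, hut, ← map_star]
    congr 1
    ext i j
    fin_cases i <;> fin_cases j <;> simp [Matrix.star_apply]
  ext ⟨p, a⟩ ⟨q, b⟩
  fin_cases a <;> fin_cases b <;> simp [hst] <;> simp [hut, auxDiagL_apply]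

lemma aux_decSet_le {A B M₂B : Type*} [NonUnitalCStarAlgebra A] [NonUnitalCStarAlgebra B]
    [NonUnitalCStarAlgebra M₂B]
    (e : Matrix (Fin 2) (Fin 2) B ≃⋆ₐ[ℂ] M₂B)
    (u : A →L[ℂ] B) (ut : A →L[ℂ] M₂B)
    (hut : ∀ x, ut x = e !![0, u x; star (u (star x)), 0]) (r : ℝ) (hr : r ∈ decSet ut) :
    ∃ s ∈ decSet u, s ≤ r := by
  obtain ⟨T₁, T₂, h₁, h₂, h₃, rfl⟩ := hr
  refine ⟨_, ⟨(auxEntry e 0 0).comp T₁, (auxEntry e 1 1).comp T₂,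
    aux_cp_diag 0 (aux_cp_hom e.symm h₁), aux_cp_diag 1 (aux_cp_hom e.symm h₂), ?_, rfl⟩,
    max_le_max (auxEntry_comp_norm _ _ _ _) (auxEntry_comp_norm _ _ _ _)⟩
  intro k M hM
  rw [aux_comp]
  have := aux_submatrix (fun x : Fin k × Fin 2 => (x, x.2))
    ((aux_comp _).1 (aux_hom e.symm ((aux_comp _).1 (h₃ k M hM))))
  convert this using 1
  ext ⟨p, a⟩ ⟨q, b⟩
  fin_cases a <;> fin_cases b <;> simp [hut, auxEntry_apply, map_star, Matrix.star_apply]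

end Helpers

/-- Let `u : A → B` be a linear map between C*-algebras and let
`ũ : A → M₂(B)`, `ũ x = [[0, u x], [u(x*)*, 0]]` (the 2×2 matrix algebra `M₂(B)` being
regarded as a C*-algebra via a `*`-isomorphism `e`).  Then `u` is decomposable iff `ũ` is,
and `‖u‖_dec = ‖ũ‖_dec`. -/
theorem decNorm_eq_decNorm_selfAdjointization
    {A B M₂B : Type*} [NonUnitalCStarAlgebra A] [NonUnitalCStarAlgebra B]
    [NonUnitalCStarAlgebra M₂B]
    (e : Matrix (Fin 2) (Fin 2) B ≃⋆ₐ[ℂ] M₂B)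
    (u : A →L[ℂ] B) (ut : A →L[ℂ] M₂B)
    (hut : ∀ x, ut x = e !![0, u x; star (u (star x)), 0]) :
    (IsDecomposable u ↔ IsDecomposable ut) ∧ decNorm u = decNorm ut := by
  refine ⟨⟨aux_decomp_forward e u ut hut, aux_decomp_backward e u ut hut⟩, ?_⟩
  have hb : BddBelow (decSet ut) := by
    refine ⟨0, ?_⟩
    rintro r ⟨S₁, S₂, -, -, -, rfl⟩
    exact le_max_of_le_left (norm_nonneg _)
  have hb' : BddBelow (decSet u) := by
    refine ⟨0, ?_⟩
    rintro r ⟨S₁, S₂, -, -, -, rfl⟩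
    exact le_max_of_le_left (norm_nonneg _)
  have hsub := aux_decSet_subset e u ut hut
  have hle := aux_decSet_le e u ut hut
  unfold decNorm
  rcases (decSet ut).eq_empty_or_nonempty with h0 | h0
  · have : decSet u = ∅ := Set.subset_eq_empty hsub h0
    rw [this, h0]
  · obtain ⟨r, hr⟩ := h0
    obtain ⟨s, hs, -⟩ := hle r hr
    apply le_antisymm
    · refine le_csInf ⟨r, hr⟩ fun r hr => ?_
      obtain ⟨s, hs, hsr⟩ := hle r hr
      exact (csInf_le hb' hs).trans hsr
    · exact csInf_le_csInf hb ⟨s, hs⟩ hsub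
end
end

section
/- Let A be a C*-algebra, n ≥ 1, and let T : ℓ∞ⁿ → A be a linear map with x_j = T(e_j). Then T is decomposable if and only if there exist a_j, b_j ∈ A with x_j = a_j* b_j for all j, and ‖T‖_dec = inf{ ‖Σ_j a_j* a_j‖^{1/2} · ‖Σ_j b_j* b_j‖^{1/2} : a_j, b_j ∈ A, x_j = a_j* b_j for all j }. -/
noncomputable section

section Aux
variable {A : Type*} [NonUnitalCStarAlgebra A] [PartialOrder A] [StarOrderedRing A]

open scoped InnerProductSpace WithCStarModule

lemma aux_cs {ι : Type*} [Fintype ι] (c d : ι → A) :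
    ‖∑ i, star (c i) * d i‖ ≤
      Real.sqrt ‖∑ i, star (c i) * c i‖ * Real.sqrt ‖∑ i, star (d i) * d i‖ := by
  let x : WithCStarModule A (ι → A) := (WithCStarModule.equiv A (ι → A)).symm (fun i => star (d i))
  let y : WithCStarModule A (ι → A) := (WithCStarModule.equiv A (ι → A)).symm (fun i => star (c i))
  have h := CStarModule.norm_inner_le (A := A) (WithCStarModule A (ι → A)) (x := x) (y := y)
  rw [WithCStarModule.pi_norm, WithCStarModule.pi_norm, WithCStarModule.pi_inner, mul_comm] at h
  simpa [x, y, WithCStarModule.inner_def] using h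

lemma aux_cfc (r : A) (hr : 0 ≤ r) (ε δ : ℝ) (hε : 0 < ε) (hδ : 0 < δ) :
    ∃ k : A, k = cfcₙ (fun s : ℝ => s / ((|s| + ε) * (s ^ 2 + δ ^ 2))) r ∧ star k = k ∧
      r * r * k = cfcₙ (fun s : ℝ => s * s * (s / ((|s| + ε) * (s ^ 2 + δ ^ 2)))) r ∧
      ‖r * r * k‖ ≤ 1 ∧
      ‖r * r - r * r * (k * (r * r + ε • r))‖ ≤ δ ^ 2 := by
  have hc : Continuous (fun s : ℝ => s / ((|s| + ε) * (s ^ 2 + δ ^ 2))) := by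
    refine Continuous.div (by fun_prop) (by fun_prop) (fun s => by positivity)
  have hrs : IsSelfAdjoint r := IsSelfAdjoint.of_nonneg hr
  have h1 : r = cfcₙ (fun s : ℝ => s) r := (cfcₙ_id' ℝ r).symm
  have h2 : r * r = cfcₙ (fun s : ℝ => s * s) r := by
    rw [cfcₙ_mul (fun s : ℝ => s) (fun s : ℝ => s) r (by fun_prop) rfl (by fun_prop) rfl, ← h1]
  have h3 : r * r * cfcₙ (fun s : ℝ => s / ((|s| + ε) * (s ^ 2 + δ ^ 2))) r =
      cfcₙ (fun s : ℝ => s * s * (s / ((|s| + ε) * (s ^ 2 + δ ^ 2)))) r := by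
    rw [cfcₙ_mul _ _ r (by fun_prop) (by simp) hc.continuousOn (by simp), ← h2]
  have h4 : r * r + ε • r = cfcₙ (fun s : ℝ => s * s + ε * s) r := by
    rw [cfcₙ_add (fun s : ℝ => s * s) (fun s : ℝ => ε * s) r (by fun_prop) (by simp) (by fun_prop) (by simp), ← h2,
      cfcₙ_const_mul ε (fun s : ℝ => s) r (by fun_prop) rfl, ← h1]
  have h5 : r * r - r * r * (cfcₙ (fun s : ℝ => s / ((|s| + ε) * (s ^ 2 + δ ^ 2))) r * (r * r + ε • r)) =
      cfcₙ (fun s : ℝ => s * s - s * s * (s / ((|s| + ε) * (s ^ 2 + δ ^ 2))) * (s * s + ε * s)) r := by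
    rw [cfcₙ_sub _ _ r (by fun_prop) (by simp)
      (by have := hc.continuousOn (s := quasispectrum ℝ r); fun_prop) (by simp),
      cfcₙ_mul (fun s : ℝ => s * s * (s / ((|s| + ε) * (s ^ 2 + δ ^ 2)))) (fun s : ℝ => s * s + ε * s) r
      (by have := hc.continuousOn (s := quasispectrum ℝ r); fun_prop) (by simp) (by fun_prop) (by simp),
      ← h3, ← h4, ← h2, mul_assoc (r * r)]
  refine ⟨_, rfl, ?_, h3, ?_, ?_⟩
  · exact (cfcₙ_predicate (R := ℝ) _ r : IsSelfAdjoint _)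
  · rw [h3]
    refine norm_cfcₙ_le fun s hs => ?_
    have hs0 : 0 ≤ s := quasispectrum_nonneg_of_nonneg r hr s hs
    rw [abs_of_nonneg hs0, Real.norm_of_nonneg (by positivity), ← mul_div_assoc, div_le_one (by positivity)]
    nlinarith [mul_nonneg hs0 (sq_nonneg δ), mul_pos hε (pow_pos hδ 2), mul_nonneg hε.le (sq_nonneg s)]
  · rw [h5]
    refine norm_cfcₙ_le fun s hs => ?_
    have hs0 : 0 ≤ s := quasispectrum_nonneg_of_nonneg r hr s hs
    have : s * s - s * s * (s / ((|s| + ε) * (s ^ 2 + δ ^ 2))) * (s * s + ε * s)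
      = δ ^ 2 * s ^ 2 / (s ^ 2 + δ ^ 2) := by
      rw [abs_of_nonneg hs0]; field_simp; ring
    rw [this, Real.norm_of_nonneg (by positivity), div_le_iff₀ (by positivity)]
    nlinarith [sq_nonneg (δ ^ 2)]

lemma aux_diff (r : A) (hr : 0 ≤ r) (ε δ δ' : ℝ) (hε : 0 < ε) (hδ : 0 < δ) (hδ' : 0 < δ')
    (hle : δ' ≤ δ) :
    ‖cfcₙ (fun s : ℝ => s * s * (s / ((|s| + ε) * (s ^ 2 + δ ^ 2)))) r -
     cfcₙ (fun s : ℝ => s * s * (s / ((|s| + ε) * (s ^ 2 + δ' ^ 2)))) r‖ ≤ δ / ε := by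
  have hc : ∀ δ : ℝ, 0 < δ → Continuous (fun s : ℝ => s * s * (s / ((|s| + ε) * (s ^ 2 + δ ^ 2)))) := by
    intro δ hδ
    refine Continuous.mul (by fun_prop) ?_
    refine Continuous.div (by fun_prop) (by fun_prop) (fun s => by positivity)
  rw [← cfcₙ_sub _ _ r (hc δ hδ).continuousOn (by simp) (hc δ' hδ').continuousOn (by simp)]
  refine norm_cfcₙ_le fun s hs => ?_
  have hs0 : 0 ≤ s := quasispectrum_nonneg_of_nonneg r hr s hs
  have e : ∀ δ : ℝ, 0 < δ → s * s * (s / ((|s| + ε) * (s ^ 2 + δ ^ 2))) =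
      s / (s + ε) - s * δ ^ 2 / ((s + ε) * (s ^ 2 + δ ^ 2)) := by
    intro δ hδ
    rw [abs_of_nonneg hs0]; field_simp; ring
  have b : ∀ δ : ℝ, 0 < δ → s * δ ^ 2 / ((s + ε) * (s ^ 2 + δ ^ 2)) ≤ δ / ε ∧
      0 ≤ s * δ ^ 2 / ((s + ε) * (s ^ 2 + δ ^ 2)) := by
    intro δ hδ
    refine ⟨?_, by positivity⟩
    rw [div_le_div_iff₀ (by positivity) hε]
    have h1 : s * δ ≤ s ^ 2 + δ ^ 2 := by nlinarith [sq_nonneg (s - δ)]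
    have h2 : ε * (s * δ) ≤ (s + ε) * (s ^ 2 + δ ^ 2) :=
      mul_le_mul (by linarith) h1 (by positivity) (by positivity)
    nlinarith
  rw [e δ hδ, e δ' hδ', Real.norm_eq_abs, abs_le]
  have h3 : δ' / ε ≤ δ / ε := by gcongr
  have := b δ hδ
  have := b δ' hδ'
  constructor <;> linarith

lemma aux_key {ι : Type*} [Fintype ι] (c d : ι → A) (ε : ℝ) (hε : 0 < ε) :
    ∃ a b : A, ∑ i, star (c i) * d i = star a * b ∧
      ‖star a * a - ∑ i, star (c i) * c i‖ ≤ ε ∧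
      star b * b ≤ ∑ i, star (d i) * d i := by
  set p := ∑ i, star (c i) * c i with hp
  set q := ∑ i, star (d i) * d i with hq
  set x := ∑ i, star (c i) * d i with hx
  have hp0 : 0 ≤ p := Finset.sum_nonneg fun i _ => star_mul_self_nonneg _
  obtain ⟨r, hr, hrp⟩ : ∃ r : A, 0 ≤ r ∧ (r * r) * (r * r) = p := by
    refine ⟨CFC.sqrt (CFC.sqrt p), CFC.sqrt_nonneg _, ?_⟩
    rw [CFC.sqrt_mul_sqrt_self _ (CFC.sqrt_nonneg _), CFC.sqrt_mul_sqrt_self _ hp0]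
  have hrs : star r = r := (IsSelfAdjoint.of_nonneg hr).star_eq
  -- pick the small parameter
  obtain ⟨η, hη, hηε⟩ : ∃ η : ℝ, 0 < η ∧ ‖(r * r + η • r) * (r * r + η • r) - p‖ ≤ ε := by
    have hcont : Continuous (fun η : ℝ => ‖(r * r + η • r) * (r * r + η • r) - p‖) := by fun_prop
    have h0 : ‖(r * r + (0 : ℝ) • r) * (r * r + (0 : ℝ) • r) - p‖ < ε := by
      simp [hrp, hε]
    have hev := (hcont.tendsto 0).eventually_lt_const h0
    have hev2 : ∀ᶠ η : ℝ in nhdsWithin 0 (Set.Ioi 0), _ := hev.filter_mono nhdsWithin_le_nhds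
    obtain ⟨η, h1, h2⟩ := (hev2.and self_mem_nhdsWithin).exists
    exact ⟨η, h2, h1.le⟩
  have hD : ∀ (e : ι → A) (D : A), ∑ i, star (e i) * e i = star D * D →
      ‖∑ i, star (e i) * d i‖ ≤ ‖D‖ * Real.sqrt ‖q‖ := by
    intro e D he
    refine (aux_cs e d).trans ?_
    rw [he, CStarRing.norm_star_mul_self, Real.sqrt_mul_self (norm_nonneg _)]
  have hux : ∀ u : A, ‖star u * x‖ ≤ ‖r * r * u‖ * Real.sqrt ‖q‖ := by
    intro u
    have := hD (fun i => c i * u) (r * r * u) (by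
      simp only [star_mul, mul_assoc, hrs]
      rw [← Finset.mul_sum]
      congr 1
      simp only [← mul_assoc]
      rw [← Finset.sum_mul, ← hp, ← hrp]; simp only [mul_assoc])
    refine le_trans (le_of_eq ?_) this
    simp only [star_mul, mul_assoc]
    rw [← Finset.mul_sum]
  have hux2 : ∀ u : A, ‖x - star u * x‖ ≤ ‖r * r - r * r * u‖ * Real.sqrt ‖q‖ := by
    intro u
    have := hD (fun i => c i - c i * u) (r * r - r * r * u) (by
      have e1 : ∀ i, star (c i - c i * u) * (c i - c i * u) = star (c i) * c i
          - (star (c i) * c i) * u - star u * (star (c i) * c i)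
          + star u * (star (c i) * c i) * u := by
        intro i; simp only [star_sub, star_mul]; noncomm_ring
      simp only [e1, Finset.sum_add_distrib, Finset.sum_sub_distrib, ← Finset.mul_sum,
        ← Finset.sum_mul]
      rw [← hp, ← hrp]
      simp only [star_sub, star_mul, hrs]; noncomm_ring)
    refine le_trans (le_of_eq ?_) this
    simp only [star_sub, star_mul, sub_mul, mul_assoc, Finset.sum_sub_distrib]
    rw [← Finset.mul_sum]
  have hδ : ∀ m : ℕ, (0 : ℝ) < 1 / ((m : ℝ) + 1) := fun m => by positivity
  choose k hk hks hrk hk1 hk2 using fun m : ℕ => aux_cfc r hr η (1 / ((m : ℝ) + 1)) hη (hδ m)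
  have ht0 : Filter.Tendsto (fun m : ℕ => 1 / ((m : ℝ) + 1)) Filter.atTop (nhds 0) :=
    tendsto_one_div_add_atTop_nhds_zero_nat
  have hcau : CauchySeq (fun m => k m * x) := by
    refine cauchySeq_of_le_tendsto_0 (fun N : ℕ => 2 * (1 / ((N : ℝ) + 1) / η * Real.sqrt ‖q‖)) ?_ ?_
    · intro m l N hm hl
      have key : ∀ m, N ≤ m → ‖k N * x - k m * x‖ ≤ 1 / ((N : ℝ) + 1) / η * Real.sqrt ‖q‖ := by
        intro m hm
        have h1 := hux (k N - k m)
        rw [star_sub, hks, hks, sub_mul, mul_sub, hrk, hrk] at h1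
        refine h1.trans ?_
        gcongr
        exact aux_diff r hr η _ _ hη (hδ N) (hδ m) (by gcongr)
      have := key m hm
      have := key l hl
      have h3 := dist_triangle_left (k m * x) (k l * x) (k N * x)
      rw [dist_eq_norm (k N * x), dist_eq_norm (k N * x)] at h3
      linarith
    · have := ((ht0.div_const η).mul_const (Real.sqrt ‖q‖)).const_mul 2
      simpa using this
  obtain ⟨b, hb⟩ := cauchySeq_tendsto_of_complete hcau
  have hsa : star (r * r + η • r) = r * r + η • r := by simp [hrs]
  refine ⟨r * r + η • r, b, ?_, ?_, ?_⟩
  · rw [hsa]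
    have h1 : Filter.Tendsto (fun m => (r * r + η • r) * (k m * x)) Filter.atTop
      (nhds ((r * r + η • r) * b)) := hb.const_mul _
    have h2 : Filter.Tendsto (fun m => (r * r + η • r) * (k m * x)) Filter.atTop (nhds x) := by
      rw [tendsto_iff_norm_sub_tendsto_zero]
      refine squeeze_zero (g := fun m : ℕ => (1 / ((m : ℝ) + 1)) ^ 2 * Real.sqrt ‖q‖)
        (fun _ => norm_nonneg _) (fun m => ?_) ?_
      · rw [norm_sub_rev]
        have := hux2 (k m * (r * r + η • r))
        rw [star_mul, hsa, hks, mul_assoc] at this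
        refine this.trans ?_
        gcongr
        exact hk2 m
      · simpa using (ht0.pow 2).mul_const (Real.sqrt ‖q‖)
    exact tendsto_nhds_unique h2 h1
  · rw [hsa]; exact hηε
  · have h1 : Filter.Tendsto (fun m => star (k m * x) * (k m * x)) Filter.atTop
      (nhds (star b * b)) := (hb.star).mul hb
    refine le_of_tendsto' h1 fun m => ?_
    set y := k m * x with hy
    have h2 : 0 ≤ ∑ i, star (d i - c i * (k m * y)) * (d i - c i * (k m * y)) :=
      Finset.sum_nonneg fun i _ => star_mul_self_nonneg _
    have h3 : ∑ i, star (d i - c i * (k m * y)) * (d i - c i * (k m * y)) =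
        q - star y * y - star y * y + star y * (star (r * r * k m) * (r * r * k m)) * y := by
      have e1 : ∀ i, star (d i - c i * (k m * y)) * (d i - c i * (k m * y)) = star (d i) * d i
          - star (star (c i) * d i) * (k m * y) - star (k m * y) * (star (c i) * d i)
          + star (k m * y) * (star (c i) * c i) * (k m * y) := by
        intro i; simp only [star_sub, star_mul, star_star]; noncomm_ring
      simp only [e1, Finset.sum_add_distrib, Finset.sum_sub_distrib, ← Finset.mul_sum,
        ← Finset.sum_mul, ← star_sum]
      rw [← hp, ← hq, ← hx, ← hrp, hy]
      simp only [star_mul, hrs, hks]; noncomm_ring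
    have h4 : star y * (star (r * r * k m) * (r * r * k m)) * y ≤ star y * y := by
      refine (CStarAlgebra.star_left_conjugate_le_norm_smul (IsSelfAdjoint.star_mul_self _)).trans ?_
      have h5 : ‖star (r * r * k m) * (r * r * k m)‖ ≤ 1 := by
        rw [CStarRing.norm_star_mul_self]
        exact mul_le_one₀ (hk1 m) (norm_nonneg _) (hk1 m)
      calc _ ≤ (1 : ℝ) • (star y * y) := smul_le_smul_of_nonneg_right h5 (star_mul_self_nonneg _)
        _ = _ := one_smul _ _
    rw [h3] at h2
    have h6 : 0 ≤ q - star y * y - star y * y + star y * y := h2.trans (by gcongr)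
    have : q - star y * y - star y * y + star y * y = q - star y * y := by abel
    rw [this] at h6
    exact sub_nonneg.mp h6
end Aux

section Aux
variable {A : Type*} [NonUnitalCStarAlgebra A] [PartialOrder A] [StarOrderedRing A]

lemma aux_sq_exists {B : Type*} [NonUnitalCStarAlgebra B] (M N : B) :
    ∃ P : B, star M * M + star N * N = star P * P := by
  let _ : PartialOrder B := CStarAlgebra.spectralOrder B
  have _ : StarOrderedRing B := CStarAlgebra.spectralOrderedRing B
  exact CStarAlgebra.nonneg_iff_eq_star_mul_self.mp
    (add_nonneg (star_mul_self_nonneg M) (star_mul_self_nonneg N))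

lemma aux_sq_add {B ι : Type*} [NonUnitalCStarAlgebra B] [Fintype ι] (M N : Matrix ι ι B)
    (hM : IsStarSquare M) (hN : IsStarSquare N) : IsStarSquare (M + N) := by
  let _ : PartialOrder B := CStarAlgebra.spectralOrder B
  have _ : StarOrderedRing B := CStarAlgebra.spectralOrderedRing B
  obtain ⟨M, rfl⟩ := hM
  obtain ⟨N, rfl⟩ := hN
  obtain ⟨P, hP⟩ := aux_sq_exists (B := CStarMatrix ι ι B) (CStarMatrix.ofMatrix M)
    (CStarMatrix.ofMatrix N)
  exact ⟨CStarMatrix.ofMatrix.symm P, hP⟩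

lemma aux_sq_add2 {ι : Type*} [Fintype ι] (M N : Matrix ι ι (Matrix (Fin 2) (Fin 2) A))
    (hM : IsStarSquare M) (hN : IsStarSquare N) : IsStarSquare (M + N) := by
  exact aux_sq_add (B := CStarMatrix (Fin 2) (Fin 2) A) M N hM hN

lemma aux_cp {n : ℕ} {B : Type*} [NonUnitalRing B] [StarRing B] [Module ℂ B] [StarModule ℂ B]
    [IsScalarTower ℂ B B] [SMulCommClass ℂ B B]
    (hB : ∀ (k : ℕ) (M N : Matrix (Fin k) (Fin k) B),
      IsStarSquare M → IsStarSquare N → IsStarSquare (M + N))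
    (c : Fin n → B) (u : (Fin n → ℂ) → B) (hu : ∀ x, u x = ∑ j, x j • (star (c j) * c j)) :
    IsCPMap u := by
  rintro k M ⟨N, rfl⟩
  have h : ∀ s : Finset (Fin n), IsStarSquare (∑ j ∈ s,
      (Matrix.of (fun a b => N a b j • c j)).conjTranspose * Matrix.of (fun a b => N a b j • c j)) := by
    intro s
    induction s using Finset.induction_on with
    | empty => exact ⟨0, by simp⟩
    | insert a s ha ih =>
      rw [Finset.sum_insert ha]
      exact hB k _ _ ⟨_, rfl⟩ ih
  convert h Finset.univ using 1
  ext a b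
  simp only [Matrix.map_apply, hu, Matrix.mul_apply, Matrix.conjTranspose_apply, Finset.sum_apply,
    Matrix.sum_apply, Matrix.of_apply, Pi.mul_apply, Pi.star_apply, Finset.sum_smul, star_smul,
    smul_mul_smul_comm]

/-- the map with prescribed values -/
def auxMap {n : ℕ} (p : Fin n → A) : (Fin n → ℂ) →L[ℂ] A :=
  ∑ j, (ContinuousLinearMap.proj (R := ℂ) (φ := fun _ : Fin n => ℂ) j).smulRight (p j)

lemma auxMap_apply {n : ℕ} (p : Fin n → A) (x : Fin n → ℂ) : auxMap p x = ∑ j, x j • p j := by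
  simp [auxMap]

lemma aux_ext {n : ℕ} (T : (Fin n → ℂ) →L[ℂ] A) (x : Fin n → ℂ) :
    T x = ∑ j, x j • T (Pi.single j 1) := by
  conv_lhs => rw [pi_eq_sum_univ' x, map_sum]
  refine Finset.sum_congr rfl fun j _ => ?_
  rw [map_smul]

lemma auxMap_cp {n : ℕ} (c : Fin n → A) : IsCPMap (auxMap (fun j => star (c j) * c j)) :=
  aux_cp (fun _ M N => aux_sq_add M N) c _ (auxMap_apply _)

lemma aux_cp2 {n : ℕ} (T : (Fin n → ℂ) →L[ℂ] A) (a b : Fin n → A)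
    (h : ∀ j, T (Pi.single j 1) = star (a j) * b j) :
    IsCPMap (fun x => (!![auxMap (fun j => star (a j) * a j) x, T x; star (T (star x)),
      auxMap (fun j => star (b j) * b j) x] : Matrix (Fin 2) (Fin 2) A)) := by
  refine aux_cp (B := Matrix (Fin 2) (Fin 2) A) (fun k => aux_sq_add2 (ι := Fin k)) (fun j => !![a j, b j; 0, 0]) _ fun x => ?_
  rw [aux_ext T x, aux_ext T (star x)]
  simp only [auxMap_apply, h]
  ext i j
  fin_cases i <;> fin_cases j <;>
    simp [Matrix.sum_apply, Matrix.mul_apply, Matrix.star_apply, star_smul]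

lemma aux_decomp (x : A) : ∃ c : Fin 4 → A, x = star (c 0) * c 0 - star (c 1) * c 1
    + Complex.I • (star (c 2) * c 2 - star (c 3) * c 3) := by
  have h := CStarAlgebra.linear_combination_nonneg x
  obtain ⟨c0, h0⟩ := CStarAlgebra.nonneg_iff_eq_star_mul_self.mp (CFC.posPart_nonneg (realPart x : A))
  obtain ⟨c1, h1⟩ := CStarAlgebra.nonneg_iff_eq_star_mul_self.mp (CFC.negPart_nonneg (realPart x : A))
  obtain ⟨c2, h2⟩ := CStarAlgebra.nonneg_iff_eq_star_mul_self.mp (CFC.posPart_nonneg (imaginaryPart x : A))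
  obtain ⟨c3, h3⟩ := CStarAlgebra.nonneg_iff_eq_star_mul_self.mp (CFC.negPart_nonneg (imaginaryPart x : A))
  refine ⟨![c0, c1, c2, c3], ?_⟩
  rw [← h, h0, h1, h2, h3, smul_sub]
  rfl

lemma aux_isDec {n : ℕ} (T : (Fin n → ℂ) →L[ℂ] A) : IsDecomposable T := by
  choose c hc using fun j => aux_decomp (T (Pi.single j 1))
  refine ⟨_, _, _, _, auxMap_cp (fun j => c j 0), auxMap_cp (fun j => c j 1),
    auxMap_cp (fun j => c j 2), auxMap_cp (fun j => c j 3), ?_⟩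
  ext x
  rw [aux_ext T x]
  simp only [add_apply, sub_apply, smul_apply, auxMap_apply, ← Finset.sum_sub_distrib, Finset.smul_sum,
    ← Finset.sum_add_distrib]
  refine Finset.sum_congr rfl fun j _ => ?_
  rw [hc j, smul_add, smul_sub, smul_comm, smul_sub (x j) (star (c j 2) * c j 2)]

lemma aux_norm {n : ℕ} (c : Fin n → A) :
    ‖auxMap (fun j => star (c j) * c j)‖ ≤ ‖∑ j, star (c j) * c j‖ := by
  refine ContinuousLinearMap.opNorm_le_bound _ (norm_nonneg _) fun x => ?_
  rw [auxMap_apply]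
  have h1 := aux_cs c (fun j => x j • c j)
  have e0 : ∑ j, star (c j) * (x j • c j) = ∑ j, x j • (star (c j) * c j) := by
    simp only [mul_smul_comm]
  rw [e0] at h1
  refine h1.trans ?_
  have h2 : ‖∑ j, star (x j • c j) * (x j • c j)‖ ≤ ‖x‖ ^ 2 * ‖∑ j, star (c j) * c j‖ := by
    have : ∑ j, star (x j • c j) * (x j • c j) ≤ (‖x‖ ^ 2) • ∑ j, star (c j) * c j := by
      rw [Finset.smul_sum]
      refine Finset.sum_le_sum fun j _ => ?_
      have e : star (x j • c j) * (x j • c j) = (‖x j‖ ^ 2) • (star (c j) * c j) := by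
        rw [star_smul, smul_mul_smul_comm, ← Complex.coe_smul]
        congr 1
        simpa using Complex.conj_mul' (x j)
      rw [e]
      refine smul_le_smul_of_nonneg_right ?_ (star_mul_self_nonneg _)
      gcongr
      exact norm_le_pi_norm x j
    have h0 : 0 ≤ ∑ j, star (x j • c j) * (x j • c j) :=
      Finset.sum_nonneg fun j _ => star_mul_self_nonneg _
    refine (CStarAlgebra.norm_le_norm_of_nonneg_of_le h0 this).trans (le_of_eq ?_)
    rw [norm_smul, Real.norm_of_nonneg (by positivity)]
  calc _ ≤ Real.sqrt ‖∑ j, star (c j) * c j‖ * Real.sqrt (‖x‖ ^ 2 * ‖∑ j, star (c j) * c j‖) := by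
        gcongr
    _ = _ := by
      rw [Real.sqrt_mul (by positivity), Real.sqrt_sq (norm_nonneg _), mul_left_comm,
        Real.mul_self_sqrt (norm_nonneg _), mul_comm]

lemma aux_factor {n : ℕ} (T : (Fin n → ℂ) →L[ℂ] A) :
    ∃ a b : Fin n → A, ∀ j, T (Pi.single j 1) = star (a j) * b j := by
  have : ∀ x : A, ∃ a b : A, x = star a * b := by
    intro x
    obtain ⟨c, hc⟩ := aux_decomp x
    obtain ⟨a, b, h, -⟩ := aux_key c
      ![c 0, - c 1, Complex.I • c 2, - (Complex.I • c 3)] 1 one_pos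
    refine ⟨a, b, ?_⟩
    rw [← h, hc]
    simp [Fin.sum_univ_four, mul_smul_comm, smul_sub]
    abel
  choose a b h using fun j => this (T (Pi.single j 1))
  exact ⟨a, b, h⟩

lemma aux_le {n : ℕ} (T : (Fin n → ℂ) →L[ℂ] A) (a b : Fin n → A)
    (h : ∀ j, T (Pi.single j 1) = star (a j) * b j) :
    ∃ r ∈ decSet T, r ≤ Real.sqrt ‖∑ j, star (a j) * a j‖ * Real.sqrt ‖∑ j, star (b j) * b j‖ := by
  have main : ∀ a b : Fin n → A, (∀ j, T (Pi.single j 1) = star (a j) * b j) →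
      ∃ r ∈ decSet T, r ≤ max ‖∑ j, star (a j) * a j‖ ‖∑ j, star (b j) * b j‖ := fun a b h =>
    ⟨_, ⟨_, _, auxMap_cp a, auxMap_cp b, aux_cp2 T a b h, rfl⟩, max_le_max (aux_norm a) (aux_norm b)⟩
  set α := ‖∑ j, star (a j) * a j‖ with hα
  set β := ‖∑ j, star (b j) * b j‖ with hβ
  have hα0 : 0 ≤ α := norm_nonneg _
  have hβ0 : 0 ≤ β := norm_nonneg _
  by_cases h0 : α = 0 ∨ β = 0
  · have hz : ∀ c : Fin n → A, ‖∑ j, star (c j) * c j‖ = 0 → ∀ j, c j = 0 := by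
      intro c hc j
      rw [norm_eq_zero, Finset.sum_eq_zero_iff_of_nonneg (fun i _ => star_mul_self_nonneg _)] at hc
      exact CStarRing.star_mul_self_eq_zero_iff _ |>.mp (hc j (Finset.mem_univ _))
    obtain ⟨r, hr, hr2⟩ := main 0 0 (fun j => by
      rw [h j]
      rcases h0 with h0 | h0
      · simp [hz a h0 j]
      · simp [hz b h0 j])
    refine ⟨r, hr, hr2.trans ?_⟩
    simp
    positivity
  · push Not at h0
    have hα1 : 0 < α := lt_of_le_of_ne hα0 (Ne.symm h0.1)
    have hβ1 : 0 < β := lt_of_le_of_ne hβ0 (Ne.symm h0.2)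
    obtain ⟨t, ht, ht2⟩ : ∃ t : ℝ, 0 < t ∧ t ^ 2 = Real.sqrt β / Real.sqrt α :=
      ⟨Real.sqrt (Real.sqrt β / Real.sqrt α), by positivity, Real.sq_sqrt (by positivity)⟩
    obtain ⟨r, hr, hr2⟩ := main (fun j => t • a j) (fun j => t⁻¹ • b j) (fun j => by
      rw [h j, star_smul, smul_mul_smul_comm]; simp [ht.ne'])
    refine ⟨r, hr, hr2.trans (le_of_eq ?_)⟩
    have e : ∀ (s : ℝ) (c : Fin n → A), ‖∑ j, star (s • c j) * (s • c j)‖ =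
        s ^ 2 * ‖∑ j, star (c j) * c j‖ := by
      intro s c
      simp only [star_smul, smul_mul_smul_comm, ← Finset.smul_sum, norm_smul]
      simp [sq]
    rw [e, e, ← hα, ← hβ, inv_pow, ht2]
    have sa := Real.sq_sqrt hα0
    have sb := Real.sq_sqrt hβ0
    have pa := Real.sqrt_pos.mpr hα1
    have pb := Real.sqrt_pos.mpr hβ1
    have e1 : Real.sqrt β / Real.sqrt α * α = Real.sqrt α * Real.sqrt β := by
      nth_rw 2 [← sa]; field_simp
    have e2 : (Real.sqrt β / Real.sqrt α)⁻¹ * β = Real.sqrt α * Real.sqrt β := by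
      nth_rw 2 [← sb]; field_simp
    rw [e1, e2, max_self]

lemma aux_ge {n : ℕ} (T : (Fin n → ℂ) →L[ℂ] A) (r : ℝ) (hr : r ∈ decSet T) (ε : ℝ) (hε : 0 < ε) :
    ∃ a b : Fin n → A, (∀ j, T (Pi.single j 1) = star (a j) * b j) ∧
      Real.sqrt ‖∑ j, star (a j) * a j‖ * Real.sqrt ‖∑ j, star (b j) * b j‖ ≤ r + n * ε := by
  obtain ⟨S₁, S₂, -, -, hS, rfl⟩ := hr
  have key : ∀ j, ∃ a b : A, T (Pi.single j 1) = star a * b ∧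
      ‖star a * a - S₁ (Pi.single j 1)‖ ≤ ε ∧ star b * b ≤ S₂ (Pi.single j 1) := by
    intro j
    obtain ⟨N, hN⟩ := hS 1 (Matrix.of fun _ _ => Pi.single j 1) ⟨Matrix.of fun _ _ => Pi.single j 1, by
      ext a b i
      by_cases hi : i = j <;> simp [Matrix.mul_apply, Pi.single_apply, hi]⟩
    have hN2 := congrFun (congrFun hN 0) 0
    simp only [Matrix.map_apply, Matrix.of_apply, Matrix.mul_apply, Matrix.conjTranspose_apply,
      Finset.univ_unique, Finset.sum_singleton] at hN2
    have h00 := congrFun (congrFun hN2 0) 0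
    have h01 := congrFun (congrFun hN2 0) 1
    have h11 := congrFun (congrFun hN2 1) 1
    simp only [Matrix.mul_apply, Matrix.star_apply] at h00 h01 h11
    simp only [Matrix.of_apply, Matrix.cons_val_zero, Matrix.cons_val_one, Matrix.cons_val_fin_one]
      at h00 h01 h11
    obtain ⟨a, b, h1, h2, h3⟩ := aux_key (fun i => N default 0 i 0) (fun i => N default 0 i 1) ε hε
    exact ⟨a, b, h01.trans h1, by rw [h00]; exact h2, by rw [h11]; exact h3⟩
  choose a b h1 h2 h3 using key
  refine ⟨a, b, h1, ?_⟩
  have hone : ∀ S : (Fin n → ℂ) →L[ℂ] A, ‖∑ j, S (Pi.single j 1)‖ ≤ ‖S‖ := by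
    intro S
    have : ∑ j, S (Pi.single j 1) = S (fun _ => 1) := by
      rw [aux_ext S (fun _ => 1)]; simp
    rw [this]
    refine (S.le_opNorm _).trans (mul_le_of_le_one_right (norm_nonneg _) ?_)
    exact (pi_norm_le_iff_of_nonneg zero_le_one).mpr (by simp)
  have ha : ‖∑ j, star (a j) * a j‖ ≤ max ‖S₁‖ ‖S₂‖ + n * ε := by
    have e : ∑ j, star (a j) * a j = ∑ j, S₁ (Pi.single j 1) +
        ∑ j, (star (a j) * a j - S₁ (Pi.single j 1)) := by
      rw [← Finset.sum_add_distrib]; simp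
    rw [e]
    refine (norm_add_le _ _).trans (add_le_add ((hone S₁).trans (le_max_left _ _)) ?_)
    refine (norm_sum_le_of_le _ (fun j _ => h2 j)).trans (by simp)
  have hb : ‖∑ j, star (b j) * b j‖ ≤ max ‖S₁‖ ‖S₂‖ + n * ε := by
    have h0 : 0 ≤ ∑ j, star (b j) * b j := Finset.sum_nonneg fun j _ => star_mul_self_nonneg _
    refine (CStarAlgebra.norm_le_norm_of_nonneg_of_le h0 (Finset.sum_le_sum fun j _ => h3 j)).trans ?_
    refine ((hone S₂).trans (le_max_right ‖S₁‖ _)).trans ?_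
    have : 0 ≤ n * ε := by positivity
    linarith
  have h0 : 0 ≤ max ‖S₁‖ ‖S₂‖ + n * ε := (norm_nonneg _).trans ha
  calc _ ≤ Real.sqrt (max ‖S₁‖ ‖S₂‖ + n * ε) * Real.sqrt (max ‖S₁‖ ‖S₂‖ + n * ε) := by gcongr
    _ = _ := Real.mul_self_sqrt h0

end Aux

/-- For a linear map `T : ℓ∞ⁿ → A` into a C*-algebra with `xⱼ = T eⱼ`, the map `T` is
decomposable iff each `xⱼ` factors as `xⱼ = aⱼ* bⱼ`, and
`‖T‖_dec = inf { ‖Σ aⱼ* aⱼ‖^(1/2) ‖Σ bⱼ* bⱼ‖^(1/2) : xⱼ = aⱼ* bⱼ }`. -/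
theorem decNorm_from_linftyn_eq
    {A : Type*} [NonUnitalCStarAlgebra A] {n : ℕ}
    (T : (Fin n → ℂ) →L[ℂ] A) :
    (IsDecomposable T ↔ ∃ a b : Fin n → A, ∀ j, T (Pi.single j 1) = star (a j) * b j) ∧
    decNorm T = sInf { r | ∃ a b : Fin n → A,
      (∀ j, T (Pi.single j 1) = star (a j) * b j) ∧
      r = Real.sqrt ‖∑ j, star (a j) * a j‖ * Real.sqrt ‖∑ j, star (b j) * b j‖ } := by
  let _ : PartialOrder A := CStarAlgebra.spectralOrder A
  have _ : StarOrderedRing A := CStarAlgebra.spectralOrderedRing A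
  obtain ⟨a₀, b₀, h₀⟩ := aux_factor T
  refine ⟨⟨fun _ => aux_factor T, fun _ => aux_isDec T⟩, ?_⟩
  have bdd1 : BddBelow (decSet T) := ⟨0, by
    rintro _ ⟨S₁, S₂, -, -, -, rfl⟩; exact (norm_nonneg _).trans (le_max_left _ _)⟩
  apply le_antisymm
  · refine le_csInf ⟨_, a₀, b₀, h₀, rfl⟩ ?_
    rintro _ ⟨a, b, h, rfl⟩
    obtain ⟨r, hr, hle⟩ := aux_le T a b h
    exact (csInf_le bdd1 hr).trans hle
  · obtain ⟨r₀, hr₀, -⟩ := aux_le T a₀ b₀ h₀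
    refine le_csInf ⟨r₀, hr₀⟩ fun r hr => ?_
    refine le_of_forall_pos_le_add fun ε hε => ?_
    obtain ⟨a, b, h, hle⟩ := aux_ge T r hr (ε / (n + 1)) (by positivity)
    refine le_trans (csInf_le (a := Real.sqrt ‖∑ j, star (a j) * a j‖ *
      Real.sqrt ‖∑ j, star (b j) * b j‖) ⟨0, ?_⟩ ⟨a, b, h, rfl⟩) (hle.trans ?_)
    · rintro _ ⟨a, b, -, rfl⟩; positivity
    · have : n * (ε / (n + 1)) ≤ ε := by
        rw [← mul_div_assoc, div_le_iff₀ (by positivity)]; nlinarith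
      linarith
end
end
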